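/- If f ∈ CMO(ℝ) is real-valued, then for every 1 < p < ∞ the function e^f is an A_p weight on ℝ; in particular e^f ∈ A_∞. -/

import Mathlib

open MeasureTheory Set Real

noncomputable def intAvg (f : ℝ → ℝ) (a b : ℝ) : ℝ := (b - a)⁻¹ * ∫ x in Set.Ioo a b, f x

noncomputable def mosc (f : ℝ → ℝ) (a b : ℝ) : ℝ :=
  (b - a)⁻¹ * ∫ x in Set.Ioo a b, |f x - intAvg f a b|

def MemBMO (f : ℝ → ℝ) : Prop := ∃ M : ℝ, ∀ a b : ℝ, a < b → mosc f a b ≤ M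

def MemCMO (f : ℝ → ℝ) : Prop :=
  MemBMO f ∧ ∀ ε : ℝ, 0 < ε → ∃ g : ℝ → ℝ, Continuous g ∧ HasCompactSupport g ∧
    ∀ a b : ℝ, a < b → mosc (fun x => f x - g x) a b ≤ ε

/-- `w` is an `A_p` weight on `ℝ` (for `1 < p < ∞`). -/
def IsApWeight (p : ℝ) (w : ℝ → ℝ) : Prop :=
  (∀ x, 0 ≤ w x) ∧
  ∃ M : ℝ, ∀ a b : ℝ, a < b →
    ((b - a)⁻¹ * ∫ x in Set.Ioo a b, w x) *
      ((b - a)⁻¹ * ∫ x in Set.Ioo a b, (w x) ^ (-(1 / (p - 1)))) ^ (p - 1) ≤ M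

theorem intAvg_eq_intervalIntegral (f : ℝ → ℝ) {a b : ℝ} (hab : a ≤ b) :
    intAvg f a b = (b - a)⁻¹ * ∫ x in a..b, f x := by
  rw [intAvg, intervalIntegral.integral_of_le hab, integral_Ioc_eq_integral_Ioo]

theorem mosc_eq_intervalIntegral (f : ℝ → ℝ) {a b : ℝ} (hab : a ≤ b) :
    mosc f a b = (b - a)⁻¹ * ∫ x in a..b, |f x - intAvg f a b| := by
  rw [mosc, intervalIntegral.integral_of_le hab, integral_Ioc_eq_integral_Ioo]

/-- The average over the dyadic subinterval of generation `n` of `[a, b]` that contains `x`. -/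
noncomputable def dyadicAvg (h : ℝ → ℝ) : ℕ → ℝ → ℝ → ℝ → ℝ
  | 0, a, b, _ => intAvg h a b
  | n + 1, a, b, x =>
    if x ≤ (a + b) / 2 then dyadicAvg h n a ((a + b) / 2) x else dyadicAvg h n ((a + b) / 2) b x

theorem measurable_dyadicAvg (h : ℝ → ℝ) (n : ℕ) (a b : ℝ) : Measurable (dyadicAvg h n a b) := by
  induction n generalizing a b with
  | zero => exact measurable_const
  | succ n ih => exact Measurable.ite measurableSet_Iic (ih _ _) (ih _ _)

theorem exists_dyadicAvg_eq_average (h : ℝ → ℝ) (n : ℕ) {a b x : ℝ} (hab : a < b)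
    (hx : x ∈ Icc a b) :
    ∃ w, x ∈ Metric.closedBall w ((b - a) / 2 / 2 ^ n) ∧
      dyadicAvg h n a b x = ⨍ y in Metric.closedBall w ((b - a) / 2 / 2 ^ n), h y := by
  induction n generalizing a b with
  | zero =>
    refine ⟨(a + b) / 2, ?_, ?_⟩
    · rw [Real.closedBall_eq_Icc]
      constructor <;> linarith [hx.1, hx.2]
    · have e : Metric.closedBall ((a + b) / 2) ((b - a) / 2 / 2 ^ 0) = Icc a b := by
        rw [Real.closedBall_eq_Icc]; congr 1 <;> ring
      rw [e, setAverage_eq, dyadicAvg, intAvg, integral_Icc_eq_integral_Ioo,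
        Real.volume_real_Icc_of_le hab.le, smul_eq_mul]
  | succ n ih =>
    by_cases hm : x ≤ (a + b) / 2
    · obtain ⟨w, hw, hE⟩ := ih (a := a) (b := (a + b) / 2) (by linarith) ⟨hx.1, hm⟩
      have e : ((a + b) / 2 - a) / 2 / 2 ^ n = (b - a) / 2 / 2 ^ (n + 1) := by
        field_simp; ring
      rw [e] at hw hE
      exact ⟨w, hw, by rw [dyadicAvg, if_pos hm, hE]⟩
    · obtain ⟨w, hw, hE⟩ := ih (a := (a + b) / 2) (b := b) (by linarith) ⟨(not_le.1 hm).le, hx.2⟩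
      have e : (b - (a + b) / 2) / 2 / 2 ^ n = (b - a) / 2 / 2 ^ (n + 1) := by
        field_simp; ring
      rw [e] at hw hE
      exact ⟨w, hw, by rw [dyadicAvg, if_neg hm, hE]⟩

theorem ae_tendsto_dyadicAvg {h : ℝ → ℝ} (hh : Integrable h) {a b : ℝ} (hab : a < b) :
    ∀ᵐ x, x ∈ Icc a b →
      Filter.Tendsto (fun n => dyadicAvg h n a b x) Filter.atTop (nhds (h x)) := by
  filter_upwards [IsUnifLocDoublingMeasure.ae_tendsto_average volume hh.locallyIntegrable 1]
    with x hx hxI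
  choose w hw hE using fun n => exists_dyadicAvg_eq_average h n hab hxI
  simp_rw [hE]
  refine hx w _ ?_ (Filter.Eventually.of_forall fun n => by simpa using hw n)
  refine tendsto_nhdsWithin_iff.2 ⟨?_, Filter.Eventually.of_forall fun n => ?_⟩
  · exact tendsto_const_nhds.div_atTop (tendsto_pow_atTop_atTop_of_one_lt one_lt_two)
  · have : 0 < b - a := sub_pos.2 hab
    simp only [mem_Ioi]; positivity

theorem abs_intAvg_sub_le {h : ℝ → ℝ} (hh : Integrable h) {a b : ℝ} (hab : a < b) (c : ℝ) :
    |intAvg h a b - c| ≤ (b - a)⁻¹ * ∫ x in a..b, |h x - c| := by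
  have hpos : 0 < b - a := sub_pos.2 hab
  have e : intAvg h a b - c = (b - a)⁻¹ * ∫ x in a..b, (h x - c) := by
    rw [intAvg_eq_intervalIntegral h hab.le, intervalIntegral.integral_sub
      hh.intervalIntegrable intervalIntegrable_const, intervalIntegral.integral_const, smul_eq_mul]
    field_simp
  rw [e, abs_mul, abs_of_pos (inv_pos.2 hpos)]
  gcongr
  exact intervalIntegral.abs_integral_le_integral_abs hab.le

theorem intervalIntegrable_abs_sub {h : ℝ → ℝ} (hh : Integrable h) (a b c : ℝ) :
    IntervalIntegrable (fun x => |h x - c|) volume a b :=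
  (hh.intervalIntegrable.sub intervalIntegrable_const).abs

/-- The averages of `h` over an interval and over either of its halves differ by at most twice the
mean oscillation. -/
theorem abs_intAvg_half_sub_le {h : ℝ → ℝ} (hh : Integrable h) {a b : ℝ} (hab : a < b) :
    |intAvg h a ((a + b) / 2) - intAvg h a b| ≤ 2 * mosc h a b ∧
      |intAvg h ((a + b) / 2) b - intAvg h a b| ≤ 2 * mosc h a b := by
  have hpos : 0 < b - a := sub_pos.2 hab
  set c := intAvg h a b with hc
  have hI := intervalIntegrable_abs_sub hh
  have hadd := intervalIntegral.integral_add_adjacent_intervals (hI a ((a + b) / 2) c)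
    (hI ((a + b) / 2) b c)
  have h1 : 0 ≤ ∫ x in a..(a + b) / 2, |h x - c| :=
    intervalIntegral.integral_nonneg (by linarith) fun x _ => abs_nonneg _
  have h2 : 0 ≤ ∫ x in (a + b) / 2..b, |h x - c| :=
    intervalIntegral.integral_nonneg (by linarith) fun x _ => abs_nonneg _
  rw [mosc_eq_intervalIntegral h hab.le, ← hc, ← hadd]
  constructor
  · refine (abs_intAvg_sub_le hh (by linarith) c).trans ?_
    have e : ((a + b) / 2 - a)⁻¹ = 2 * (b - a)⁻¹ := by
      rw [show (a + b) / 2 - a = (b - a) / 2 by ring]; field_simp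
    rw [e, mul_assoc]
    gcongr
    linarith
  · refine (abs_intAvg_sub_le hh (by linarith) c).trans ?_
    have e : (b - (a + b) / 2)⁻¹ = 2 * (b - a)⁻¹ := by
      rw [show b - (a + b) / 2 = (b - a) / 2 by ring]; field_simp
    rw [e, mul_assoc]
    gcongr
    linarith

theorem exp_fiftyOne_fiftieths_le : exp (1 + 1 / 50) ≤ 3 := by
  have h1 := Real.exp_one_lt_d9
  have h2 : exp (1 / 50) ≤ 1 / (1 - 1 / 50) :=
    Real.exp_bound_div_one_sub_of_interval (by norm_num) (by norm_num)
  rw [exp_add]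
  calc exp 1 * exp (1 / 50) ≤ 2.7182818286 * (1 / (1 - 1 / 50)) := by gcongr
    _ ≤ 3 := by norm_num

theorem lintegral_exp_dyadicAvg_le {h : ℝ → ℝ} (hh : Integrable h) {A B : ℝ}
    (hosc : ∀ a b, A ≤ a → a < b → b ≤ B → mosc h a b ≤ 1 / 100) (n : ℕ) {a b : ℝ}
    (ha : A ≤ a) (hab : a < b) (hb : b ≤ B) (c : ℝ) (hc : |intAvg h a b - c| ≤ 1 + 1 / 50) :
    ∫⁻ x in Ioc a b, ENNReal.ofReal (exp |dyadicAvg h n a b x - c|) ≤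
      ENNReal.ofReal (3 * (b - a) + 10 * ∫ x in a..b, |h x - c|) := by
  induction n generalizing a b c with
  | zero =>
    have h0 : 0 ≤ ∫ x in a..b, |h x - c| :=
      intervalIntegral.integral_nonneg hab.le fun x _ => abs_nonneg _
    simp only [dyadicAvg, lintegral_const, Measure.restrict_apply_univ, Real.volume_Ioc]
    rw [← ENNReal.ofReal_mul (exp_pos _).le]
    apply ENNReal.ofReal_le_ofReal
    have h1 : exp |intAvg h a b - c| ≤ 3 := (exp_le_exp.2 hc).trans exp_fiftyOne_fiftieths_le
    nlinarith [sub_pos.2 hab]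
  | succ n ih =>
    have hpos : 0 < b - a := sub_pos.2 hab
    have hosc' := hosc a b ha hab hb
    have close : ∀ c, |intAvg h a b - c| ≤ 1 →
        ∫⁻ x in Ioc a b, ENNReal.ofReal (exp |dyadicAvg h (n + 1) a b x - c|) ≤
          ENNReal.ofReal (3 * (b - a) + 10 * ∫ x in a..b, |h x - c|) := by
      intro c hc
      set m := (a + b) / 2 with hm
      have ham : a < m := by linarith
      have hmb : m < b := by linarith
      obtain ⟨hl, hr⟩ := abs_intAvg_half_sub_le hh hab
      have hl' := ih ha ham (by linarith) c
        ((abs_sub_le _ (intAvg h a b) _).trans (by linarith))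
      have hr' := ih (by linarith) hmb hb c
        ((abs_sub_le _ (intAvg h a b) _).trans (by linarith))
      have hI := intervalIntegrable_abs_sub hh
      have h1 : 0 ≤ ∫ x in a..m, |h x - c| :=
        intervalIntegral.integral_nonneg ham.le fun x _ => abs_nonneg _
      have h2 : 0 ≤ ∫ x in m..b, |h x - c| :=
        intervalIntegral.integral_nonneg hmb.le fun x _ => abs_nonneg _
      rw [← Ioc_union_Ioc_eq_Ioc ham.le hmb.le,
        ← intervalIntegral.integral_add_adjacent_intervals (hI a m c) (hI m b c),
        show 3 * (b - a) + 10 * ((∫ x in a..m, |h x - c|) + ∫ x in m..b, |h x - c|) =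
          (3 * (m - a) + 10 * ∫ x in a..m, |h x - c|) +
            (3 * (b - m) + 10 * ∫ x in m..b, |h x - c|) by ring,
        ENNReal.ofReal_add (by nlinarith) (by nlinarith)]
      refine (lintegral_union_le _ _ _).trans (add_le_add (hl'.trans' ?_) (hr'.trans' ?_))
      · refine (setLIntegral_congr_fun measurableSet_Ioc fun x hx => ?_).le
        simp only [dyadicAvg]
        rw [if_pos hx.2]
      · refine (setLIntegral_congr_fun measurableSet_Ioc fun x hx => ?_).le
        simp only [dyadicAvg]
        rw [if_neg (not_le.2 hx.1)]
    rcases le_or_gt |intAvg h a b - c| 1 with h1 | h1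
    · exact close c h1
    have key := close (intAvg h a b) (by simp)
    calc ∫⁻ x in Ioc a b, ENNReal.ofReal (exp |dyadicAvg h (n + 1) a b x - c|)
        ≤ ∫⁻ x in Ioc a b, ENNReal.ofReal 3 *
            ENNReal.ofReal (exp |dyadicAvg h (n + 1) a b x - intAvg h a b|) := by
          refine lintegral_mono fun x => ?_
          rw [← ENNReal.ofReal_mul (by norm_num)]
          apply ENNReal.ofReal_le_ofReal
          calc exp |dyadicAvg h (n + 1) a b x - c|
              ≤ exp ((1 + 1 / 50) + |dyadicAvg h (n + 1) a b x - intAvg h a b|) := by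
                apply exp_le_exp.2
                have := abs_sub_le (dyadicAvg h (n + 1) a b x) (intAvg h a b) c
                linarith
            _ ≤ _ := by
                rw [exp_add]
                gcongr
                exact exp_fiftyOne_fiftieths_le
      _ = ENNReal.ofReal 3 *
            ∫⁻ x in Ioc a b, ENNReal.ofReal (exp |dyadicAvg h (n + 1) a b x - intAvg h a b|) :=
          lintegral_const_mul' _ _ ENNReal.ofReal_ne_top
      _ ≤ ENNReal.ofReal 3 *
            ENNReal.ofReal (3 * (b - a) + 10 * ∫ x in a..b, |h x - intAvg h a b|) := by gcongr
      _ ≤ _ := by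
          rw [← ENNReal.ofReal_mul (by norm_num)]
          apply ENNReal.ofReal_le_ofReal
          have h2 := h1.le.trans (abs_intAvg_sub_le hh hab c)
          rw [mosc_eq_intervalIntegral h hab.le] at hosc'
          rw [inv_mul_le_iff₀ hpos] at hosc'
          rw [le_inv_mul_iff₀ hpos] at h2
          linarith

/-- A form of the John–Nirenberg inequality: functions with small mean oscillation on all
subintervals of `[a, b]` have a uniformly exponentially integrable oscillation. -/
theorem lintegral_exp_abs_sub_intAvg_le {h : ℝ → ℝ} {a b : ℝ} (hab : a < b)
    (hh : IntegrableOn h (Ioo a b))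
    (hosc : ∀ a' b', a ≤ a' → a' < b' → b' ≤ b → mosc h a' b' ≤ 1 / 100) :
    ∫⁻ x in Ioo a b, ENNReal.ofReal (exp |h x - intAvg h a b|) ≤
      ENNReal.ofReal (4 * (b - a)) := by
  set k := (Ioo a b).indicator h with hk
  have hkint : Integrable k := (integrable_indicator_iff measurableSet_Ioo).2 hh
  have hkeq : ∀ a' b', a ≤ a' → b' ≤ b → EqOn k h (Ioo a' b') := fun a' b' h1 h2 x hx =>
    indicator_of_mem (Ioo_subset_Ioo h1 h2 hx) h
  have havg : ∀ a' b', a ≤ a' → b' ≤ b → intAvg k a' b' = intAvg h a' b' := by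
    intro a' b' h1 h2
    rw [intAvg, intAvg, setIntegral_congr_fun measurableSet_Ioo (hkeq a' b' h1 h2)]
  have hkosc : ∀ a' b', a ≤ a' → a' < b' → b' ≤ b → mosc k a' b' ≤ 1 / 100 := by
    intro a' b' h1 h2 h3
    refine (hosc a' b' h1 h2 h3).trans' (le_of_eq ?_)
    rw [mosc, mosc, havg a' b' h1 h3]
    congr 1
    refine setIntegral_congr_fun measurableSet_Ioo fun x hx => ?_
    simp only [hkeq a' b' h1 h3 hx]
  have hc := havg a b le_rfl le_rfl
  have hn : ∀ n, ∫⁻ x in Ioo a b, ENNReal.ofReal (exp |dyadicAvg k n a b x - intAvg k a b|) ≤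
      ENNReal.ofReal (4 * (b - a)) := by
    intro n
    refine (lintegral_mono_set Ioo_subset_Ioc_self).trans
      ((lintegral_exp_dyadicAvg_le hkint hkosc n le_rfl hab le_rfl (intAvg k a b)
        (by norm_num)).trans (ENNReal.ofReal_le_ofReal ?_))
    have := hkosc a b le_rfl hab le_rfl
    rw [mosc_eq_intervalIntegral k hab.le, inv_mul_le_iff₀ (sub_pos.2 hab)] at this
    linarith [sub_pos.2 hab]
  calc ∫⁻ x in Ioo a b, ENNReal.ofReal (exp |h x - intAvg h a b|)
      = ∫⁻ x in Ioo a b, Filter.liminf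
          (fun n => ENNReal.ofReal (exp |dyadicAvg k n a b x - intAvg k a b|)) Filter.atTop := by
        refine setLIntegral_congr_fun_ae measurableSet_Ioo ?_
        filter_upwards [ae_tendsto_dyadicAvg hkint hab] with x hx hxI
        have := hx (Ioo_subset_Icc_self hxI)
        rw [hkeq a b le_rfl le_rfl hxI] at this
        rw [hc]
        refine (Filter.Tendsto.liminf_eq ?_).symm
        exact ENNReal.tendsto_ofReal
          ((continuous_exp.tendsto _).comp (this.sub_const (intAvg h a b)).abs)
    _ ≤ Filter.liminf (fun n => ∫⁻ x in Ioo a b,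
          ENNReal.ofReal (exp |dyadicAvg k n a b x - intAvg k a b|)) Filter.atTop := by
        refine lintegral_liminf_le fun n => ?_
        have := measurable_dyadicAvg k n a b
        fun_prop
    _ ≤ ENNReal.ofReal (4 * (b - a)) :=
        (Filter.liminf_le_liminf (Filter.Eventually.of_forall hn)).trans
          (by simp)

/-- Upper bound for the average of `exp ∘ u` when `u` exceeds a constant by at most the oscillation
of a function with small mean oscillation. -/
theorem average_exp_le {h u : ℝ → ℝ} {a b d : ℝ} (hab : a < b)
    (hh : IntegrableOn h (Ioo a b))
    (hosc : ∀ a' b', a ≤ a' → a' < b' → b' ≤ b → mosc h a' b' ≤ 1 / 100)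
    (hu : ∀ x, u x ≤ d + |h x - intAvg h a b|) :
    (b - a)⁻¹ * ∫ x in Ioo a b, exp (u x) ≤ 4 * exp d := by
  have hpos : 0 < b - a := sub_pos.2 hab
  rw [inv_mul_le_iff₀ hpos]
  by_cases hm : AEStronglyMeasurable (fun x => exp (u x)) (volume.restrict (Ioo a b))
  · rw [integral_eq_lintegral_of_nonneg_ae (Filter.Eventually.of_forall fun x => (exp_pos _).le) hm]
    refine ENNReal.toReal_le_of_le_ofReal (by positivity) ?_
    calc ∫⁻ x in Ioo a b, ENNReal.ofReal (exp (u x))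
        ≤ ∫⁻ x in Ioo a b, ENNReal.ofReal (exp d) *
            ENNReal.ofReal (exp |h x - intAvg h a b|) := by
          refine lintegral_mono fun x => ?_
          rw [← ENNReal.ofReal_mul (exp_pos d).le, ← exp_add]
          exact ENNReal.ofReal_le_ofReal (exp_le_exp.2 (hu x))
      _ = ENNReal.ofReal (exp d) *
            ∫⁻ x in Ioo a b, ENNReal.ofReal (exp |h x - intAvg h a b|) :=
          lintegral_const_mul' _ _ ENNReal.ofReal_ne_top
      _ ≤ ENNReal.ofReal (exp d) * ENNReal.ofReal (4 * (b - a)) := by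
          gcongr
          exact lintegral_exp_abs_sub_intAvg_le hab hh hosc
      _ = ENNReal.ofReal ((b - a) * (4 * exp d)) := by
          rw [← ENNReal.ofReal_mul (exp_pos d).le]
          congr 1
          ring
  · rw [integral_non_aestronglyMeasurable hm]
    positivity

theorem integrable_of_integrable_exp {μ : Measure ℝ} {f : ℝ → ℝ} {s : ℝ} (hs : 0 < s)
    (h1 : Integrable (fun x => exp (f x)) μ) (h2 : Integrable (fun x => exp (-(s * f x))) μ) :
    Integrable f μ := by
  refine (h1.add (h2.const_mul s⁻¹)).mono' ?_ (Filter.Eventually.of_forall fun x => ?_)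
  · have := (measurable_log.comp_aemeasurable h1.aemeasurable).aestronglyMeasurable
    simpa [Function.comp_def] using this
  · have e1 := add_one_le_exp (f x)
    have e2 := add_one_le_exp (-(s * f x))
    have e3 : s⁻¹ * (-(s * f x)) ≤ s⁻¹ * exp (-(s * f x)) := by gcongr; linarith
    have e4 : s⁻¹ * (-(s * f x)) = -f x := by field_simp
    have e5 : 0 < s⁻¹ * exp (-(s * f x)) := by positivity
    have e6 := exp_pos (f x)
    simp only [Pi.add_apply, norm_eq_abs]
    exact abs_le.2 ⟨by linarith, by linarith⟩

theorem intAvg_const_mul (k : ℝ) (f : ℝ → ℝ) (a b : ℝ) :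
    intAvg (fun x => k * f x) a b = k * intAvg f a b := by
  rw [intAvg, intAvg, integral_const_mul]
  ring

theorem mosc_const_mul {k : ℝ} (hk : 0 ≤ k) (f : ℝ → ℝ) (a b : ℝ) :
    mosc (fun x => k * f x) a b = k * mosc f a b := by
  simp_rw [mosc, intAvg_const_mul, ← mul_sub, abs_mul, abs_of_nonneg hk, integral_const_mul]
  ring

theorem stmt10 (f : ℝ → ℝ) (hf : MemCMO f) :
    ∀ p : ℝ, 1 < p → IsApWeight p (fun x => Real.exp (f x)) := by
  intro p hp
  refine ⟨fun x => (exp_pos _).le, ?_⟩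
  have hp' : 0 < p - 1 := sub_pos.2 hp
  obtain ⟨s, hs⟩ : ∃ s, s = 1 / (p - 1) := ⟨_, rfl⟩
  have hs0 : 0 < s := by rw [hs]; positivity
  have hsp : s * (p - 1) = 1 := by rw [hs]; field_simp
  obtain ⟨k, hk⟩ : ∃ k, k = max 1 s := ⟨_, rfl⟩
  have hk1 : 1 ≤ k := hk ▸ le_max_left _ _
  have hks : s ≤ k := hk ▸ le_max_right _ _
  obtain ⟨g, hgc, hgs, hg⟩ := hf.2 (1 / 100 / k) (by positivity)
  obtain ⟨G, hG⟩ := hgs.exists_bound_of_continuous hgc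
  refine ⟨4 * exp G * (4 ^ (p - 1) * exp G), fun a b hab => ?_⟩
  simp only [← hs]
  have hpow : ∀ x, exp (f x) ^ (-s) = exp (-(s * f x)) := fun x => by
    rw [← exp_mul]; ring_nf
  simp_rw [hpow]
  by_cases hint : IntegrableOn f (Ioo a b)
  · set u := fun x => f x - g x with hu
    have hgint : IntegrableOn g (Ioo a b) := (hgc.integrable_of_hasCompactSupport hgs).integrableOn
    have hosc : ∀ a' b', a ≤ a' → a' < b' → b' ≤ b →
        mosc (fun x => k * u x) a' b' ≤ 1 / 100 := by
      intro a' b' _ h _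
      rw [mosc_const_mul (by linarith)]
      calc k * mosc u a' b' ≤ k * (1 / 100 / k) := by gcongr; exact hg a' b' h
        _ = 1 / 100 := by field_simp
    have hkint : IntegrableOn (fun x => k * u x) (Ioo a b) := (hint.sub hgint).const_mul k
    have hdev : ∀ x, |k * u x - intAvg (fun x => k * u x) a b| = k * |u x - intAvg u a b| := by
      intro x
      rw [intAvg_const_mul, ← mul_sub, abs_mul, abs_of_nonneg (by linarith)]
    have h1 := average_exp_le (u := f) (d := intAvg u a b + G) hab hkint hosc fun x => by
      rw [hdev]
      have e1 := le_abs_self (u x - intAvg u a b)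
      have e2 := (le_abs_self (g x)).trans (hG x)
      have e3 : 1 * |u x - intAvg u a b| ≤ k * |u x - intAvg u a b| := by gcongr
      have e4 : f x = u x + g x := by simp [hu]
      linarith
    have h2 := average_exp_le (u := fun x => -(s * f x)) (d := s * (-intAvg u a b + G)) hab
      hkint hosc fun x => by
        rw [hdev]
        have e1 := neg_abs_le (u x - intAvg u a b)
        have e2 := (neg_le_abs (g x)).trans (hG x)
        have e3 : s * |u x - intAvg u a b| ≤ k * |u x - intAvg u a b| := by gcongr
        have e4 : f x = u x + g x := by simp [hu]
        have e5 : s * -f x ≤ s * (-intAvg u a b + G + |u x - intAvg u a b|) := by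
          gcongr; linarith
        linarith
    have hpos : 0 < b - a := sub_pos.2 hab
    have h3 : 0 ≤ (b - a)⁻¹ * ∫ x in Ioo a b, exp (-(s * f x)) :=
      mul_nonneg (by positivity) (integral_nonneg fun x => (exp_pos _).le)
    calc _ ≤ 4 * exp (intAvg u a b + G) * (4 * exp (s * (-intAvg u a b + G))) ^ (p - 1) := by
          gcongr
      _ = 4 * exp (intAvg u a b + G) * (4 ^ (p - 1) * exp (-intAvg u a b + G)) := by
          rw [mul_rpow (by norm_num) (exp_pos _).le, ← exp_mul,
            show s * (-intAvg u a b + G) * (p - 1) = s * (p - 1) * (-intAvg u a b + G) by ring,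
            hsp, one_mul]
      _ = _ := by
          rw [exp_add, exp_add, exp_neg]
          field_simp
  · have hzero : (∫ x in Ioo a b, exp (f x)) = 0 ∨ (∫ x in Ioo a b, exp (-(s * f x))) = 0 := by
      by_contra! hne
      exact hint (integrable_of_integrable_exp hs0
        (not_imp_comm.1 integral_undef hne.1) (not_imp_comm.1 integral_undef hne.2))
    rcases hzero with h0 | h0
    · rw [h0, mul_zero, zero_mul]
      positivity
    · rw [h0, mul_zero, zero_rpow hp'.ne', mul_zero]
      positivity
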